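/- Let Δ₁ and Δ₂ be simplicial complexes on disjoint finite vertex sets V₁ and V₂, let Δ₁ ⊔ Δ₂ denote the simplicial complex on V₁ ∪ V₂ whose faces are exactly the faces of Δ₁ together with the faces of Δ₂, and let q ≥ 1 be an integer. With the convention σ₀Δ = {∅}, a subset F ⊆ V₁ ∪ V₂ is a face of σ_q(Δ₁ ⊔ Δ₂) if and only if there exists an integer j with 0 ≤ j ≤ q such that F ∩ V₁ is a face of σ_jΔ₁ and F ∩ V₂ is a face of σ_{q−j}Δ₂. -/

import Mathlib

open SimpleGraph Finset

/-- A simplicial complex on the vertex type `V`: closed under subsets and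
containing every singleton. -/
def IsComplex {V : Type*} (Δ : Set (Finset V)) : Prop :=
  (∀ F ∈ Δ, ∀ G : Finset V, G ⊆ F → G ∈ Δ) ∧ (∀ v : V, ({v} : Finset V) ∈ Δ)

/-- The `q`-secant complex `σ_q Δ`: its faces are unions of `q` faces of `Δ`. -/
def secant {V : Type*} [DecidableEq V] (q : ℕ) (Δ : Set (Finset V)) : Set (Finset V) :=
  {F | ∃ f : Fin q → Finset V, (∀ i, f i ∈ Δ) ∧ F = Finset.univ.sup f}

/-- Clique complex of a graph. -/
def cliqueComplex {V : Type*} (G : SimpleGraph V) : Set (Finset V) :=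
  {F | G.IsClique (F : Set V)}

/-- `S` is a union of `q` cliques of `G`. -/
def CliqueCoverable {V : Type*} (G : SimpleGraph V) (q : ℕ) (S : Set V) : Prop :=
  ∃ f : Fin q → Set V, (∀ i, G.IsClique (f i)) ∧ S = ⋃ i, f i

/-- Membership in the family `𝓕_{q,1}`: `H` is not the edgeless graph on `q+1`
vertices, its vertex set is not a union of `q` cliques, but every proper subset is. -/
def MemF1 {V : Type*} [Fintype V] (q : ℕ) (H : SimpleGraph V) : Prop :=
  ¬(Fintype.card V = q + 1 ∧ H = ⊥) ∧
  ¬CliqueCoverable H q Set.univ ∧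
  ∀ S : Set V, S ≠ Set.univ → CliqueCoverable H q S

/-- `𝓕_{q,1}`-freeness: no induced subgraph belongs to `𝓕_{q,1}`. -/
def F1Free {V : Type*} [Fintype V] [DecidableEq V] (q : ℕ) (G : SimpleGraph V) : Prop :=
  ∀ S : Finset V, ¬MemF1 q (G.induce (S : Set V))

/-- Elementary bipartite graph: a bipartite graph such that removing any vertex from
each side leaves a graph with a perfect matching. -/
def ElemBipartite {V : Type*} (H : SimpleGraph V) : Prop :=
  ∃ U W : Set V, Disjoint U W ∧ U ∪ W = Set.univ ∧
    (∀ a b, H.Adj a b → (a ∈ U ∧ b ∈ W) ∨ (a ∈ W ∧ b ∈ U)) ∧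
    ∀ u ∈ U, ∀ w ∈ W, ∃ M : H.Subgraph, M.verts = Set.univ \ {u, w} ∧ M.IsMatching

/-- Membership in the family `𝓕_{q,2}`: a disjoint union of an elementary bipartite
graph on `2j+2` vertices (1 ≤ j ≤ q) with `q - j` isolated vertices. -/
def MemF2 {V : Type*} [Fintype V] [DecidableEq V] (q : ℕ) (G : SimpleGraph V) : Prop :=
  ∃ j : ℕ, 1 ≤ j ∧ j ≤ q ∧ ∃ S : Finset V,
    S.card = 2 * j + 2 ∧ Fintype.card V = (2 * j + 2) + (q - j) ∧
    (∀ a b, G.Adj a b → a ∈ S ∧ b ∈ S) ∧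
    ElemBipartite (G.induce (S : Set V))

/-- `𝓕_{q,2}`-freeness. -/
def F2Free {V : Type*} [Fintype V] [DecidableEq V] (q : ℕ) (G : SimpleGraph V) : Prop :=
  ∀ S : Finset V, ¬MemF2 q (G.induce (S : Set V))

/-- `G` has no induced cycle `C_n`. -/
def CycleFree {V : Type*} [Fintype V] [DecidableEq V] (G : SimpleGraph V) (n : ℕ) : Prop :=
  ∀ S : Finset V, IsEmpty (G.induce (S : Set V) ≃g cycleGraph n)

/-- `q`-secant chordality: `𝓕_{q,1}`-free, `𝓕_{q,2}`-free and `C_{2q+p}`-free for all `p ≥ 3`. -/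
def SecantChordal {V : Type*} [Fintype V] [DecidableEq V] (q : ℕ) (G : SimpleGraph V) : Prop :=
  F1Free q G ∧ F2Free q G ∧ ∀ p : ℕ, 3 ≤ p → CycleFree G (2 * q + p)

/-- Edge contraction `G/e` where `e = {u, v}`: the vertex `u` is removed and `v` plays
the role of the new identified vertex `z`, which is adjacent to every vertex adjacent
in `G` to `u` or to `v`; other adjacencies are unchanged. -/
def contractEdge {V : Type*} (G : SimpleGraph V) (u v : V) :
    SimpleGraph {a : V // a ≠ u} :=
  SimpleGraph.fromRel (fun a b =>
    G.Adj a.1 b.1 ∨ (a.1 = v ∧ G.Adj u b.1) ∨ (b.1 = v ∧ G.Adj a.1 u))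

/-- Independent set: a set of pairwise nonadjacent vertices. -/
def IsIndepSet {V : Type*} (G : SimpleGraph V) (S : Set V) : Prop :=
  ∀ a ∈ S, ∀ b ∈ S, a ≠ b → ¬G.Adj a b

/-- A simplicial complex on the vertex set `Vs` inside an ambient type. -/
def IsComplexOn {V : Type*} (Vs : Finset V) (Δ : Set (Finset V)) : Prop :=
  (∀ F ∈ Δ, F ⊆ Vs) ∧ (∀ F ∈ Δ, ∀ G : Finset V, G ⊆ F → G ∈ Δ) ∧
    (∀ v ∈ Vs, ({v} : Finset V) ∈ Δ)

theorem secant_zero_mem {V : Type*} [DecidableEq V] (Δ : Set (Finset V)) (F : Finset V) :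
    F ∈ secant 0 Δ ↔ F = ∅ := by
  simp [secant]

theorem secant_succ_mem {V : Type*} [DecidableEq V] (n : ℕ) (Δ : Set (Finset V))
    (F : Finset V) :
    F ∈ secant (n + 1) Δ ↔ ∃ A ∈ Δ, ∃ G ∈ secant n Δ, F = A ∪ G := by
  constructor
  · rintro ⟨f, hf, rfl⟩
    refine ⟨f 0, hf 0, _, ⟨fun i => f i.succ, fun i => hf _, rfl⟩, ?_⟩
    ext x
    simp [Finset.mem_sup, Fin.exists_fin_succ]
  · rintro ⟨A, hA, G, ⟨g, hg, rfl⟩, rfl⟩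
    refine ⟨Fin.cons A g, fun i => ?_, ?_⟩
    · refine Fin.cases ?_ (fun i => ?_) i
      · simpa using hA
      · simpa using hg i
    · ext x
      simp [Finset.mem_sup, Fin.exists_fin_succ]

theorem secant_mono {V : Type*} [DecidableEq V] (n : ℕ) {Δ Δ' : Set (Finset V)}
    (h : Δ ⊆ Δ') : secant n Δ ⊆ secant n Δ' := by
  rintro F ⟨f, hf, rfl⟩
  exact ⟨f, fun i => h (hf i), rfl⟩

theorem secant_add {V : Type*} [DecidableEq V] (Δ : Set (Finset V)) (b : ℕ) (G : Finset V)
    (hG : G ∈ secant b Δ) (a : ℕ) : ∀ F ∈ secant a Δ, F ∪ G ∈ secant (a + b) Δ := by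
  induction a with
  | zero =>
    intro F hF
    rw [secant_zero_mem] at hF
    subst hF
    simpa using hG
  | succ n ih =>
    intro F hF
    obtain ⟨A, hA, H, hH, rfl⟩ := (secant_succ_mem _ _ _).1 hF
    rw [Nat.add_right_comm]
    exact (secant_succ_mem _ _ _).2 ⟨A, hA, _, ih H hH, Finset.union_assoc _ _ _⟩

theorem secant_split {V : Type*} [DecidableEq V]
    (V₁ V₂ : Finset V) (hdisj : Disjoint V₁ V₂)
    (Δ₁ Δ₂ : Set (Finset V)) (h₁ : ∀ F ∈ Δ₁, F ⊆ V₁) (h₂ : ∀ F ∈ Δ₂, F ⊆ V₂)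
    (q : ℕ) : ∀ F ∈ secant q (Δ₁ ∪ Δ₂),
      ∃ j : ℕ, j ≤ q ∧ F ∩ V₁ ∈ secant j Δ₁ ∧ F ∩ V₂ ∈ secant (q - j) Δ₂ := by
  induction q with
  | zero =>
    intro F hF
    rw [secant_zero_mem] at hF
    subst hF
    exact ⟨0, le_rfl, by simp [secant_zero_mem], by simp [secant_zero_mem]⟩
  | succ n ih =>
    intro F hF
    obtain ⟨A, hA, G, hG, rfl⟩ := (secant_succ_mem _ _ _).1 hF
    obtain ⟨j, hj, hj1, hj2⟩ := ih G hG
    rcases hA with hA | hA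
    · have e2 : A ∩ V₂ = ∅ :=
        Finset.disjoint_iff_inter_eq_empty.1 (hdisj.mono_left (h₁ A hA))
      refine ⟨j + 1, by omega, ?_, ?_⟩
      · rw [Finset.union_inter_distrib_right, Finset.inter_eq_left.2 (h₁ A hA)]
        exact (secant_succ_mem _ _ _).2 ⟨A, hA, _, hj1, rfl⟩
      · rw [Finset.union_inter_distrib_right, e2, Finset.empty_union, Nat.add_sub_add_right]
        exact hj2
    · have e2 : A ∩ V₁ = ∅ :=
        Finset.disjoint_iff_inter_eq_empty.1 (hdisj.symm.mono_left (h₂ A hA))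
      refine ⟨j, by omega, ?_, ?_⟩
      · rw [Finset.union_inter_distrib_right, e2, Finset.empty_union]
        exact hj1
      · rw [Finset.union_inter_distrib_right, Finset.inter_eq_left.2 (h₂ A hA),
          Nat.sub_add_comm hj]
        exact (secant_succ_mem _ _ _).2 ⟨A, hA, _, hj2, rfl⟩

/-- faces of the `q`-secant complex of a disjoint union of complexes.
(Note `secant 0 Δ = {∅}` by definition, which is the required convention `σ₀Δ = {∅}`.) -/
theorem secant_disjUnion_mem_iff {V : Type*} [Fintype V] [DecidableEq V]
    (V₁ V₂ : Finset V) (hdisj : Disjoint V₁ V₂)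
    (Δ₁ Δ₂ : Set (Finset V)) (h₁ : IsComplexOn V₁ Δ₁) (h₂ : IsComplexOn V₂ Δ₂)
    (q : ℕ) (hq : 1 ≤ q) (F : Finset V) (hF : F ⊆ V₁ ∪ V₂) :
    F ∈ secant q (Δ₁ ∪ Δ₂) ↔
      ∃ j : ℕ, j ≤ q ∧ F ∩ V₁ ∈ secant j Δ₁ ∧ F ∩ V₂ ∈ secant (q - j) Δ₂ := by
  constructor
  · exact secant_split V₁ V₂ hdisj Δ₁ Δ₂ h₁.1 h₂.1 q F
  · rintro ⟨j, hj, hj1, hj2⟩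
    have h := secant_add (Δ₁ ∪ Δ₂) _ _ (secant_mono _ Set.subset_union_right hj2) _ _
      (secant_mono _ Set.subset_union_left hj1)
    rwa [← Finset.inter_union_distrib_left, Finset.inter_eq_left.2 hF,
      Nat.add_sub_cancel' hj] at h
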